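/- In the Darboux parametrization Φ(s,t) of the Fresnel surface with 0 < ε₁ < ε₂ < ε₃, the first fundamental form coefficients satisfy F(s,t) = ⟨∂ₛΦ, ∂ₜΦ⟩ = 0, i.e. the coordinate lines s = const and t = const are orthogonal, and moreover E(s,t) = ⟨∂ₛΦ,∂ₛΦ⟩ = (s²t − (ε₁+ε₂+ε₃)st + (ε₁ε₂+ε₁ε₃+ε₂ε₃)t − ε₁ε₂ε₃) / (4t(s−ε₁)(s−ε₂)(s−ε₃)) and G(s,t) = ⟨∂ₜΦ,∂ₜΦ⟩ = ε₁ε₂ε₃(s−t)/(4t²(t−ε₁)(t−ε₂)(t−ε₃)). -/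

import Mathlib

/-- The Darboux parametrization of the Fresnel surface (indices mod 3). -/
noncomputable def darbouxPhi (ε σ : Fin 3 → ℝ) (s t : ℝ) (i : Fin 3) : ℝ :=
  σ i * Real.sqrt (ε 0 * ε 1 * ε 2 * (ε i - s) * (t⁻¹ - (ε i)⁻¹)
    / ((ε i - ε (i + 1)) * (ε i - ε (i + 2))))

lemma aux_s (c e Q D σ s : ℝ) (h : 0 < c * (e - s) * Q / D) :
    deriv (fun s' => σ * Real.sqrt (c * (e - s') * Q / D)) s
      = σ * Real.sqrt (c * (e - s) * Q / D) / (2 * (s - e)) := by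
  have h1 : HasDerivAt (fun s' : ℝ => c * (e - s') * Q / D) (c * (-1) * Q / D) s :=
    ((((hasDerivAt_id s).const_sub e).const_mul c).mul_const Q).div_const D
  rw [((h1.sqrt h.ne').const_mul σ).deriv]
  have hs : e - s ≠ 0 := by rintro h0; simp [h0] at h
  have hs' : s - e ≠ 0 := by intro h0; apply hs; linarith
  have hq := Real.sqrt_pos.2 h
  have hm := Real.sq_sqrt h.le
  generalize Real.sqrt (c * (e - s) * Q / D) = r at *
  rw [mul_div_assoc σ]
  congr 1
  rw [div_eq_div_iff (by positivity) (by simpa using hs')]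
  linear_combination (-2) * hm

lemma aux_t (c e D σ t : ℝ) (ht : t ≠ 0) (he : e ≠ 0) (h : 0 < c * (t⁻¹ - e⁻¹) / D) :
    deriv (fun t' => σ * Real.sqrt (c * (t'⁻¹ - e⁻¹) / D)) t
      = σ * Real.sqrt (c * (t⁻¹ - e⁻¹) / D) * e / (2 * t * (t - e)) := by
  have h1 : HasDerivAt (fun t' : ℝ => c * (t'⁻¹ - e⁻¹) / D) (c * (-(t ^ 2)⁻¹) / D) t :=
    (((hasDerivAt_inv ht).sub_const e⁻¹).const_mul c).div_const D
  rw [((h1.sqrt h.ne').const_mul σ).deriv]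
  have hs' : t - e ≠ 0 := by
    intro h0
    have : t = e := by linarith
    simp [this] at h
  have hq := Real.sqrt_pos.2 h
  have hm := Real.sq_sqrt h.le
  generalize Real.sqrt (c * (t⁻¹ - e⁻¹) / D) = r at *
  rw [mul_assoc σ, mul_div_assoc σ]
  congr 1
  rw [div_eq_div_iff (by positivity) (by simp [hs', ht])]
  have h2 : c * -(t ^ 2)⁻¹ / D * (2 * t * (t - e)) = 2 * e * (c * (t⁻¹ - e⁻¹) / D) := by
    by_cases hD : D = 0
    · simp [hD]
    field_simp
    ring
  rw [h2, ← hm]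
  ring

/-- The coefficients of the first fundamental form of the Fresnel surface in Darboux
coordinates: `F = 0` (the coordinate lines are orthogonal) and the explicit formulas
for `E` and `G`. -/
theorem stmt6 (ε σ : Fin 3 → ℝ) (h₀ : 0 < ε 0) (h₀₁ : ε 0 < ε 1) (h₁₂ : ε 1 < ε 2)
    (hσ : ∀ i, σ i = 1 ∨ σ i = -1) (s t : ℝ)
    (hst : (ε 0 < s ∧ s < ε 1 ∧ ε 1 < t ∧ t < ε 2)
      ∨ (ε 0 < t ∧ t < ε 1 ∧ ε 1 < s ∧ s < ε 2)) :
    (∑ i : Fin 3, deriv (fun s' => darbouxPhi ε σ s' t i) s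
        * deriv (fun t' => darbouxPhi ε σ s t' i) t = 0) ∧
    (∑ i : Fin 3, (deriv (fun s' => darbouxPhi ε σ s' t i) s) ^ 2
        = (s ^ 2 * t - (ε 0 + ε 1 + ε 2) * s * t
            + (ε 0 * ε 1 + ε 0 * ε 2 + ε 1 * ε 2) * t - ε 0 * ε 1 * ε 2)
          / (4 * t * (s - ε 0) * (s - ε 1) * (s - ε 2))) ∧
    (∑ i : Fin 3, (deriv (fun t' => darbouxPhi ε σ s t' i) t) ^ 2
        = ε 0 * ε 1 * ε 2 * (s - t)
          / (4 * t ^ 2 * (t - ε 0) * (t - ε 1) * (t - ε 2))) := by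
  have h1 : 0 < ε 1 := h₀.trans h₀₁
  have h2 : 0 < ε 2 := h1.trans h₁₂
  have ht : 0 < t := by rcases hst with h | h <;> linarith [h.1, h.2.1, h.2.2.1]
  have f0 : ∀ t e : ℝ, 0 < t → 0 < e → t⁻¹ - e⁻¹ = (e - t) / (t * e) := by
    intro t e ht he
    field_simp
  have hc : 0 < ε 0 * ε 1 * ε 2 := by positivity
  have a01 : 0 < ε 1 - ε 0 := by linarith
  have a12 : 0 < ε 2 - ε 1 := by linarith
  have a02 : 0 < ε 2 - ε 0 := by linarith
  have p0 : 0 < (ε 0 - s) * (ε 0 - t) := by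
    rcases hst with ⟨b1, b2, b3, b4⟩ | ⟨b1, b2, b3, b4⟩ <;>
      exact mul_pos_of_neg_of_neg (by linarith) (by linarith)
  have p1 : (ε 1 - s) * (ε 1 - t) < 0 := by
    rcases hst with ⟨b1, b2, b3, b4⟩ | ⟨b1, b2, b3, b4⟩
    · exact mul_neg_of_pos_of_neg (by linarith) (by linarith)
    · exact mul_neg_of_neg_of_pos (by linarith) (by linarith)
  have p2 : 0 < (ε 2 - s) * (ε 2 - t) := by
    rcases hst with ⟨b1, b2, b3, b4⟩ | ⟨b1, b2, b3, b4⟩ <;>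
      exact mul_pos (by linarith) (by linarith)
  have i11 : (1 : Fin 3) + 1 = 2 := rfl
  have i12 : (1 : Fin 3) + 2 = 0 := rfl
  have i21 : (2 : Fin 3) + 1 = 0 := rfl
  have i22 : (2 : Fin 3) + 2 = 1 := rfl
  have key : ∀ i : Fin 3, 0 < ε 0 * ε 1 * ε 2 * (ε i - s) * (t⁻¹ - (ε i)⁻¹)
      / ((ε i - ε (i + 1)) * (ε i - ε (i + 2))) := by
    intro i
    have hi : 0 < ε i := by fin_cases i <;> assumption
    rw [f0 t _ ht hi]
    have : ε 0 * ε 1 * ε 2 * (ε i - s) * ((ε i - t) / (t * ε i))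
        / ((ε i - ε (i + 1)) * (ε i - ε (i + 2)))
      = ε 0 * ε 1 * ε 2 / (t * ε i) * (((ε i - s) * (ε i - t))
        / ((ε i - ε (i + 1)) * (ε i - ε (i + 2)))) := by ring
    rw [this]
    refine mul_pos (by positivity) ?_
    fin_cases i
    · exact div_pos p0 (mul_pos_of_neg_of_neg (by simp; linarith) (by simp; linarith))
    · exact div_pos_of_neg_of_neg p1
        (mul_neg_of_neg_of_pos (by simp [i11]; linarith) (by simp [i12]; linarith))
    · exact div_pos p2 (mul_pos (by simp [i21]; linarith) (by simp [i22]; linarith))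
  have ds : ∀ i : Fin 3, deriv (fun s' => darbouxPhi ε σ s' t i) s
      = darbouxPhi ε σ s t i / (2 * (s - ε i)) := fun i => aux_s _ _ _ _ _ _ (key i)
  have dt : ∀ i : Fin 3, deriv (fun t' => darbouxPhi ε σ s t' i) t
      = darbouxPhi ε σ s t i * ε i / (2 * t * (t - ε i)) := fun i =>
    aux_t _ _ _ _ _ ht.ne' (by fin_cases i; exacts [h₀.ne', h1.ne', h2.ne']) (key i)
  have sq : ∀ i : Fin 3, darbouxPhi ε σ s t i ^ 2
      = ε 0 * ε 1 * ε 2 * (ε i - s) * ((ε i - t) / (t * ε i))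
      / ((ε i - ε (i + 1)) * (ε i - ε (i + 2))) := by
    intro i
    have hi : 0 < ε i := by fin_cases i <;> assumption
    rw [← f0 t _ ht hi]
    unfold darbouxPhi
    rw [mul_pow, Real.sq_sqrt (key i).le]
    rcases hσ i with h | h <;> simp [h]
  have s0 := sq 0
  have s1 := sq 1
  have s2 := sq 2
  simp only [i11, i12, i21, i22, zero_add] at s0 s1 s2
  simp only [ds, dt, Fin.sum_univ_three]
  generalize darbouxPhi ε σ s t 0 = x at *
  generalize darbouxPhi ε σ s t 1 = y at *
  generalize darbouxPhi ε σ s t 2 = z at *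
  clear ds dt sq key hσ hst f0 i11 i12 i21 i22
  generalize ε 0 = a at *
  generalize ε 1 = b at *
  generalize ε 2 = c at *
  have ne : ∀ u v : ℝ, u - v ≠ 0 → v - u ≠ 0 := fun u v h h' => h (by linarith)
  have n1 := left_ne_zero_of_mul p0.ne'
  have n2 := right_ne_zero_of_mul p0.ne'
  have n3 := left_ne_zero_of_mul p1.ne
  have n4 := right_ne_zero_of_mul p1.ne
  have n5 := left_ne_zero_of_mul p2.ne'
  have n6 := right_ne_zero_of_mul p2.ne'
  have m1 := ne _ _ n1
  have m2 := ne _ _ n2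
  have m3 := ne _ _ n3
  have m4 := ne _ _ n4
  have m5 := ne _ _ n5
  have m6 := ne _ _ n6
  have q1 := a01.ne'
  have q2 := a12.ne'
  have q3 := a02.ne'
  have r1 := ne _ _ q1
  have r2 := ne _ _ q2
  have r3 := ne _ _ q3
  have e1 : ∀ w d e f : ℝ, w / d * (w * e / f) = w ^ 2 * e / (d * f) := by
    intros; ring
  simp only [e1, div_pow, mul_pow, s0, s1, s2]
  clear s0 s1 s2 e1
  rw [← neg_sub s a, ← neg_sub s b, ← neg_sub s c, ← neg_sub t a, ← neg_sub t b, ← neg_sub t c,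
    ← neg_sub b a, ← neg_sub c b, ← neg_sub c a]
  refine ⟨?_, ?_, ?_⟩
  · field_simp
    ring
  · field_simp
    ring
  · field_simp
    ring
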